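/- Coordinate representation of the mapped residuals and constancy of the orthogonal component: assume y = A u† with A one-to-one. Along any solution of the continuous-time EnKF flow, each mapped residual can be written as A r^{(j)}(t) = Σ_{k=1}^J q_{jk}(t) A e^{(k)}(0) + ρ^{(j)}(t), where the matrix Q(t) = (q_{jk}(t)) satisfies dQ/dt = −(1/J) F L (with L as in the representation of the mapped deviations), and where ρ^{(j)}(t) is the ⟨·,·⟩_Γ-orthogonal projection of A r^{(j)}(t) onto the orthogonal complement in Y of span{A e^{(k)}(0)}_{k=1}^J. Moreover ρ^{(j)}(t) = ρ^{(j)}(0) = ρ^{(1)}(0) for all j and all t ≥ 0, i.e. the orthogonal component is constant in time and independent of the ensemble member. -/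

import Mathlib

open scoped BigOperators
open RealInnerProductSpace Matrix

noncomputable section

/-- The Γ-weighted inner product `⟨a,b⟩_Γ = ⟨Γ⁻¹ a, b⟩` on `ℝ^K`. -/
def gInner {K : ℕ} (Γ : Matrix (Fin K) (Fin K) ℝ)
    (a b : EuclideanSpace ℝ (Fin K)) : ℝ :=
  ⟪Matrix.toEuclideanLin Γ⁻¹ a, b⟫

/-- Ensemble mean. -/
def ensMean {X : Type*} [AddCommGroup X] [Module ℝ X] {J : ℕ} (v : Fin J → X) : X :=
  (J : ℝ)⁻¹ • ∑ j, v j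

/-- Right-hand side of the continuous-time EnKF flow. -/
def enkfRHS {X : Type*} [NormedAddCommGroup X] [InnerProductSpace ℝ X] {K J : ℕ}
    (A : X →L[ℝ] EuclideanSpace ℝ (Fin K)) (Γ : Matrix (Fin K) (Fin K) ℝ)
    (y : EuclideanSpace ℝ (Fin K)) (v : Fin J → X) (j : Fin J) : X :=
  (J : ℝ)⁻¹ • ∑ k, gInner Γ (A (v k - ensMean v)) (y - A (v j)) • (v k - ensMean v)

/-- `u : ℝ → Fin J → X` solves the continuous-time EnKF flow on `[0,∞)`. -/
def IsEnKFSolution {X : Type*} [NormedAddCommGroup X] [InnerProductSpace ℝ X] {K J : ℕ}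
    (A : X →L[ℝ] EuclideanSpace ℝ (Fin K)) (Γ : Matrix (Fin K) (Fin K) ℝ)
    (y : EuclideanSpace ℝ (Fin K)) (u : ℝ → Fin J → X) : Prop :=
  ∀ j : Fin J, ∀ t ∈ Set.Ici (0 : ℝ),
    HasDerivWithinAt (fun s => u s j) (enkfRHS A Γ y (u t) j) (Set.Ici 0) t

/-- The deviation Gram matrix `E` of an ensemble. -/
def matE {X : Type*} [NormedAddCommGroup X] [InnerProductSpace ℝ X] {K J : ℕ}
    (A : X →L[ℝ] EuclideanSpace ℝ (Fin K)) (Γ : Matrix (Fin K) (Fin K) ℝ)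
    (v : Fin J → X) : Matrix (Fin J) (Fin J) ℝ :=
  Matrix.of fun l j => gInner Γ (A (v l - ensMean v)) (A (v j - ensMean v))

/-- The residual/deviation cross Gram matrix `F` of an ensemble. -/
def matF {X : Type*} [NormedAddCommGroup X] [InnerProductSpace ℝ X] {K J : ℕ}
    (A : X →L[ℝ] EuclideanSpace ℝ (Fin K)) (Γ : Matrix (Fin K) (Fin K) ℝ)
    (udag : X) (v : Fin J → X) : Matrix (Fin J) (Fin J) ℝ :=
  Matrix.of fun l j => gInner Γ (A (v l - udag)) (A (v j - ensMean v))

/-- The residual Gram matrix `R` of an ensemble. -/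
def matR {X : Type*} [NormedAddCommGroup X] [InnerProductSpace ℝ X] {K J : ℕ}
    (A : X →L[ℝ] EuclideanSpace ℝ (Fin K)) (Γ : Matrix (Fin K) (Fin K) ℝ)
    (udag : X) (v : Fin J → X) : Matrix (Fin J) (Fin J) ℝ :=
  Matrix.of fun l j => gInner Γ (A (v l - udag)) (A (v j - udag))

/-- The orthogonal complement of a subspace of `ℝ^K` w.r.t. the Γ-weighted inner product. -/
def gOrth {K : ℕ} (Γ : Matrix (Fin K) (Fin K) ℝ)
    (S : Submodule ℝ (EuclideanSpace ℝ (Fin K))) :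
    Submodule ℝ (EuclideanSpace ℝ (Fin K)) where
  carrier := {w | ∀ v ∈ S, gInner Γ v w = 0}
  add_mem' := by
    intro a b ha hb v hv
    have h1 := ha v hv
    have h2 := hb v hv
    simp only [gInner, Set.mem_setOf_eq] at *
    rw [inner_add_right, h1, h2, add_zero]
  zero_mem' := by
    intro v hv
    simp [gInner]
  smul_mem' := by
    intro c a ha v hv
    have h1 := ha v hv
    simp only [gInner, Set.mem_setOf_eq] at *
    rw [inner_smul_right, h1, mul_zero]

/-- The orthogonal complement of a subspace of `X` w.r.t. the inner product
`⟨v,w⟩_* = ⟨A v, A w⟩_Γ`. -/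
def gOrthX {X : Type*} [NormedAddCommGroup X] [InnerProductSpace ℝ X] {K : ℕ}
    (A : X →L[ℝ] EuclideanSpace ℝ (Fin K)) (Γ : Matrix (Fin K) (Fin K) ℝ)
    (S : Submodule ℝ X) : Submodule ℝ X where
  carrier := {w | ∀ v ∈ S, gInner Γ (A v) (A w) = 0}
  add_mem' := by
    intro a b ha hb v hv
    have h1 := ha v hv
    have h2 := hb v hv
    simp only [gInner, Set.mem_setOf_eq, map_add] at *
    rw [inner_add_right, h1, h2, add_zero]
  zero_mem' := by
    intro v hv
    simp [gInner]
  smul_mem' := by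
    intro c a ha v hv
    have h1 := ha v hv
    simp only [gInner, Set.mem_setOf_eq, _root_.map_smul] at *
    rw [inner_smul_right, h1, mul_zero]


theorem gInner_comm_aux {K : ℕ} {Γ : Matrix (Fin K) (Fin K) ℝ} (hΓ : Γ.PosDef)
    (a b : EuclideanSpace ℝ (Fin K)) : gInner Γ a b = gInner Γ b a := by
  have h : (Matrix.toEuclideanLin Γ⁻¹).IsSymmetric :=
    Matrix.isHermitian_iff_isSymmetric.1 hΓ.inv.isHermitian
  unfold gInner
  rw [h a b, real_inner_comm]

theorem gInner_pos_aux {K : ℕ} {Γ : Matrix (Fin K) (Fin K) ℝ} (hΓ : Γ.PosDef)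
    (a : EuclideanSpace ℝ (Fin K)) (h : gInner Γ a a = 0) : a = 0 := by
  by_contra hne
  have hne' : a.ofLp ≠ 0 := by
    intro h0
    apply hne
    ext i
    simp [h0]
  have := hΓ.inv.dotProduct_mulVec_pos hne'
  unfold gInner at h
  rw [EuclideanSpace.inner_eq_star_dotProduct] at h
  simp [Matrix.toLpLin_apply] at h this
  linarith

theorem gInner_decomp_aux {K : ℕ} {Γ : Matrix (Fin K) (Fin K) ℝ} (hΓ : Γ.PosDef)
    (S : Submodule ℝ (EuclideanSpace ℝ (Fin K))) (x : EuclideanSpace ℝ (Fin K)) :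
    ∃ s ∈ S, x - s ∈ gOrth Γ S := by
  let B : EuclideanSpace ℝ (Fin K) →ₗ[ℝ] EuclideanSpace ℝ (Fin K) →ₗ[ℝ] ℝ :=
    (innerₗ (EuclideanSpace ℝ (Fin K))).comp (Matrix.toEuclideanLin Γ⁻¹)
  have hB : ∀ a b, B a b = gInner Γ a b := fun a b => rfl
  let f : S →ₗ[ℝ] Module.Dual ℝ S := (B.domRestrict₁₂ S S)
  have hinj : Function.Injective f := by
    rw [← LinearMap.ker_eq_bot, LinearMap.ker_eq_bot']
    intro m hm
    have h1 : f m m = 0 := by rw [hm]; rfl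
    exact Subtype.ext (gInner_pos_aux hΓ _ h1)
  have hsurj : Function.Surjective f :=
    (LinearMap.injective_iff_surjective_of_finrank_eq_finrank
      (Subspace.dual_finrank_eq (K := ℝ) (V := S)).symm).1 hinj
  obtain ⟨s, hs⟩ := hsurj ((B x).domRestrict S)
  refine ⟨s, s.2, fun v hv => ?_⟩
  have h1 : f s ⟨v, hv⟩ = B x v := by rw [hs]; rfl
  have h2 : B s v = B x v := h1
  rw [gInner_comm_aux hΓ, ← hB, map_sub, LinearMap.sub_apply, h2, sub_self]

theorem enkf_residual_coordinate_representation
    {X : Type*} [NormedAddCommGroup X] [InnerProductSpace ℝ X]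
    {K J : ℕ} (hJ : 0 < J)
    (A : X →L[ℝ] EuclideanSpace ℝ (Fin K)) (hA : Function.Injective A)
    (Γ : Matrix (Fin K) (Fin K) ℝ) (hΓ : Γ.PosDef)
    (udag : X) (u : ℝ → Fin J → X)
    (hu : IsEnKFSolution A Γ (A udag) u)
    (L : ℝ → Matrix (Fin J) (Fin J) ℝ)
    (hL0 : L 0 = 1)
    (hLode : ∀ t ∈ Set.Ici (0 : ℝ), ∀ i j : Fin J,
      HasDerivWithinAt (fun s => L s i j)
        ((-(J : ℝ)⁻¹) * (matE A Γ (u t) * L t) i j) (Set.Ici 0) t)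
    (hLrep : ∀ j : Fin J, ∀ t ∈ Set.Ici (0 : ℝ),
      A (u t j - ensMean (u t)) = ∑ k, L t j k • A (u 0 k - ensMean (u 0))) :
    ∃ Q : ℝ → Matrix (Fin J) (Fin J) ℝ,
      ∃ ρ : Fin J → ℝ → EuclideanSpace ℝ (Fin K),
        (∀ t ∈ Set.Ici (0 : ℝ), ∀ i j : Fin J,
          HasDerivWithinAt (fun s => Q s i j)
            ((-(J : ℝ)⁻¹) * (matF A Γ udag (u t) * L t) i j) (Set.Ici 0) t) ∧
        (∀ j : Fin J, ∀ t ∈ Set.Ici (0 : ℝ),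
          A (u t j - udag) = (∑ k, Q t j k • A (u 0 k - ensMean (u 0))) + ρ j t ∧
          ρ j t ∈ gOrth Γ
            (Submodule.span ℝ (Set.range fun k => A (u 0 k - ensMean (u 0))))) ∧
        (∀ j : Fin J, ∀ t ∈ Set.Ici (0 : ℝ), ρ j t = ρ j 0) ∧
        ∀ j j' : Fin J, ρ j 0 = ρ j' 0 := by
  obtain ⟨s, hs, hρ⟩ := gInner_decomp_aux hΓ
    (Submodule.span ℝ (Set.range fun k => A (u 0 k - ensMean (u 0))))
    (A (ensMean (u 0) - udag))
  obtain ⟨c, hc⟩ := (Submodule.mem_span_range_iff_exists_fun ℝ).1 hs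
  -- continuity
  have huc : ∀ j, ContinuousOn (fun t => u t j) (Set.Ici 0) :=
    fun j t ht => (hu j t ht).continuousWithinAt
  have hLc : ∀ i j, ContinuousOn (fun t => L t i j) (Set.Ici 0) :=
    fun i j t ht => (hLode t ht i j).continuousWithinAt
  have hmc : ContinuousOn (fun t => ensMean (u t)) (Set.Ici 0) := by
    unfold ensMean
    exact (continuousOn_finsetSum _ fun j _ => huc j).const_smul _
  let g : Fin J → Fin J → ℝ → ℝ := fun i j t =>
    (-(J : ℝ)⁻¹) * (matF A Γ udag (u t) * L t) i j
  have hg : ∀ i j, ContinuousOn (g i j) (Set.Ici 0) := by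
    intro i j
    simp only [g, Matrix.mul_apply, matF, Matrix.of_apply, gInner]
    refine continuousOn_const.mul (continuousOn_finsetSum _ fun k _ => ContinuousOn.mul ?_ (hLc k j))
    refine ContinuousOn.inner ?_ ?_
    · exact (LinearMap.continuous_of_finiteDimensional _).comp_continuousOn
        (A.continuous.comp_continuousOn ((huc i).sub continuousOn_const))
    · exact A.continuous.comp_continuousOn ((huc k).sub hmc)
  let h : Fin J → Fin J → ℝ → ℝ := fun i j t => g i j (max t 0)
  have hh : ∀ i j, Continuous (h i j) := fun i j =>
    (hg i j).comp_continuous (by fun_prop) (fun t => Set.mem_Ici.2 (le_max_right _ _))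
  let Q : ℝ → Matrix (Fin J) (Fin J) ℝ := fun t =>
    Matrix.of fun i j => (if i = j then 1 else 0) + c j + ∫ τ in (0:ℝ)..t, h i j τ
  have hQ : ∀ t ∈ Set.Ici (0 : ℝ), ∀ i j : Fin J,
      HasDerivWithinAt (fun s => Q s i j) (g i j t) (Set.Ici 0) t := by
    intro t ht i j
    have h1 : HasDerivAt (fun s => ∫ τ in (0:ℝ)..s, h i j τ) (h i j t) t :=
      intervalIntegral.integral_hasDerivAt_right ((hh i j).intervalIntegrable _ _)
        ((hh i j).stronglyMeasurableAtFilter _ _) (hh i j).continuousAt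
    have h2 : h i j t = g i j t := by simp only [h]; rw [max_eq_left ht]
    rw [h2] at h1
    exact (h1.const_add _).hasDerivWithinAt
  let ρ : Fin J → ℝ → EuclideanSpace ℝ (Fin K) := fun j t =>
    A (u t j - udag) - ∑ k, Q t j k • A (u 0 k - ensMean (u 0))
  have hderiv : ∀ j, ∀ t ∈ Set.Ici (0:ℝ), HasDerivWithinAt (ρ j) 0 (Set.Ici 0) t := by
    intro j t ht
    have h1 := A.hasFDerivAt.comp_hasDerivWithinAt t ((hu j t ht).sub_const udag)
    have h2 : HasDerivWithinAt (fun t => ∑ k, Q t j k • A (u 0 k - ensMean (u 0)))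
        (∑ k, g j k t • A (u 0 k - ensMean (u 0))) (Set.Ici 0) t :=
      HasDerivWithinAt.fun_sum fun k _ => (hQ t ht j k).smul_const _
    refine (h1.sub h2).congr_deriv ?_
    rw [sub_eq_zero]
    have e1 : ∀ k, gInner Γ (A (u t k - ensMean (u t))) (A udag - A (u t j))
        = - matF A Γ udag (u t) j k := by
      intro k
      simp only [matF, Matrix.of_apply]
      rw [gInner_comm_aux hΓ (A (u t j - udag)), ← map_sub, ← neg_sub (u t j) udag, map_neg]
      simp only [gInner, inner_neg_right]
    simp only [enkfRHS, map_smul, map_sum, e1, g, Matrix.mul_apply]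
    simp only [fun k => hLrep k t ht, Finset.smul_sum, Finset.mul_sum, Finset.sum_smul, smul_smul]
    rw [Finset.sum_comm]
    refine Finset.sum_congr rfl fun k _ => Finset.sum_congr rfl fun l _ => ?_
    congr 1
    ring
  have hconst : ∀ j, ∀ t ∈ Set.Ici (0:ℝ), ρ j t = ρ j 0 := by
    intro j t ht
    refine constant_of_has_deriv_right_zero (a := 0) (b := t) ?_ ?_ t ⟨ht, le_rfl⟩
    · exact fun x hx => ((hderiv j x hx.1).continuousWithinAt).mono fun y hy => hy.1
    · exact fun x hx => (hderiv j x hx.1).mono (Set.Ici_subset_Ici.2 hx.1)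
  have hzero : ∀ j, ρ j 0 = A (ensMean (u 0) - udag) - s := by
    intro j
    have : ∀ k, Q 0 j k = (if j = k then 1 else 0) + c k := by
      intro k; simp [Q]
    simp only [ρ, this, add_smul, Finset.sum_add_distrib, hc]
    simp only [ite_smul, one_smul, zero_smul, Finset.sum_ite_eq, Finset.mem_univ, if_true, map_sub]
    abel
  refine ⟨Q, ρ, hQ, fun j t ht => ⟨?_, ?_⟩, hconst, fun j j' => by rw [hzero, hzero]⟩
  · simp only [ρ]; abel
  · rw [hconst j t ht, hzero]; exact hρ


end
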